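/- Suppose K is algebraically closed. Let B₁, B₂ be symplectic forms on E and let V ⊆ E be a k-dimensional subspace isotropic with respect to both. Suppose there exist alternating k × k matrices A = (a_{ij}) and M = (b_{ij}) over K, not both zero, and a basis v₁,…,v_k of V, such that for every i = 1,…,k one has B₁(Σ_j a_{ij}v_j, e) + B₂(Σ_j b_{ij}v_j, e) = 0 for all e ∈ E. Then there exist scalars (c₁,c₂) ∈ K² with (c₁,c₂) ≠ (0,0) and a nonzero even-dimensional subspace V' ⊆ V such that (c₁B₁ + c₂B₂)(v', e) = 0 for all v' ∈ V' and all e ∈ E. -/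

import Mathlib

open Module

def IsSymplectic {K E : Type*} [Field K] [AddCommGroup E] [Module K E]
    (B : E →ₗ[K] E →ₗ[K] K) : Prop :=
  (∀ v, B v v = 0) ∧ ∀ v, (∀ w, B v w = 0) → v = 0

def IsIsotropic {K E : Type*} [Field K] [AddCommGroup E] [Module K E]
    (B : E →ₗ[K] E →ₗ[K] K) (V : Submodule K E) : Prop :=
  ∀ v ∈ V, ∀ w ∈ V, B v w = 0

/-- A square matrix is alternating if it is skew-symmetric with zero diagonal. -/
def Matrix.IsAlternating {K : Type*} [Field K] {k : ℕ}
    (M : Matrix (Fin k) (Fin k) K) : Prop :=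
  M.transpose = -M ∧ ∀ i, M i i = 0

open scoped Matrix

/-- The codimension of the radical of an alternating form is even. -/
theorem LinearMap.IsAlt.even_finrank_add_finrank_ker {K E : Type*} [Field K] [AddCommGroup E]
    [Module K E] [FiniteDimensional K E] {B : E →ₗ[K] E →ₗ[K] K} (hB : B.IsAlt) :
    Even (finrank K E + finrank K (LinearMap.ker B)) := by
  induction hn : finrank K E using Nat.strong_induction_on generalizing E with
  | _ n ih =>
    by_cases h0 : B = 0
    · subst h0
      rw [LinearMap.ker_zero, finrank_top, hn]
      exact ⟨n, rfl⟩
    obtain ⟨x, y, hxy⟩ : ∃ x y, B x y ≠ 0 := by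
      by_contra! h
      exact h0 (LinearMap.ext₂ h)
    have hyx : B y x = -B x y := (hB.neg x y).symm
    let f : E →ₗ[K] K × K := (B x).prod (B y)
    have hf : Function.Surjective f := by
      rintro ⟨a, b⟩
      refine ⟨(a / B x y) • y - (b / B x y) • x, ?_⟩
      ext
      · simp [f, hB x, hxy]
      · simp [f, hB y, hyx, hxy]
    have hdim : finrank K (LinearMap.ker f) + 2 = n := by
      have := f.finrank_range_add_finrank_ker
      rw [LinearMap.range_eq_top.2 hf, finrank_top, finrank_prod, finrank_self] at this
      omega
    let C := B.domRestrict₁₂ (LinearMap.ker f) (LinearMap.ker f)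
    have hC : C.IsAlt := fun u => hB u
    have hker : (LinearMap.ker C).map (LinearMap.ker f).subtype = LinearMap.ker B := by
      ext w
      constructor
      · rintro ⟨u, hu, rfl⟩
        have hux : B u x = 0 := hB.isRefl _ _ (congrArg Prod.fst (LinearMap.mem_ker.1 u.2))
        have huy : B u y = 0 := hB.isRefl _ _ (congrArg Prod.snd (LinearMap.mem_ker.1 u.2))
        refine LinearMap.mem_ker.2 (LinearMap.ext fun z => ?_)
        have hz : z - (B x z / B x y) • y + (B y z / B x y) • x ∈ LinearMap.ker f := by
          rw [LinearMap.mem_ker]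
          ext
          · simp [f, hB x, hxy]
          · simp [f, hB y, hyx, hxy]
        have h := LinearMap.congr_fun (LinearMap.mem_ker.1 hu) ⟨_, hz⟩
        simpa [C, LinearMap.domRestrict₁₂_apply, hux, huy] using h
      · intro hw
        have hw' : ∀ z, B w z = 0 := LinearMap.congr_fun (LinearMap.mem_ker.1 hw)
        refine ⟨⟨w, LinearMap.mem_ker.2 (Prod.ext (hB.isRefl _ _ (hw' x))
          (hB.isRefl _ _ (hw' y)))⟩, LinearMap.mem_ker.2 (LinearMap.ext fun z => hw' z), rfl⟩
    have hcard : finrank K (LinearMap.ker C) = finrank K (LinearMap.ker B) := by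
      rw [← hker, Submodule.finrank_map_subtype_eq]
    have h := ih _ (by omega) hC rfl
    rw [hcard] at h
    rw [← hdim]
    grind

namespace Matrix.IsAlternating

variable {K : Type*} [Field K] {k : ℕ} {M N : Matrix (Fin k) (Fin k) K}

theorem sub_smul (hM : M.IsAlternating) (hN : N.IsAlternating) (c : K) :
    (M - c • N).IsAlternating := by
  refine ⟨?_, fun i => by simp [hM.2 i, hN.2 i]⟩
  rw [transpose_sub, transpose_smul, hM.1, hN.1, smul_neg]
  abel

theorem dotProduct_mulVec_self (hM : M.IsAlternating) (x : Fin k → K) : x ⬝ᵥ M *ᵥ x = 0 := by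
  simp only [dotProduct, mulVec, Finset.mul_sum]
  rw [← Finset.sum_product']
  refine Finset.sum_involution (fun p _ => p.swap) (fun p _ => ?_) (fun p _ hp h => hp ?_)
    (fun _ _ => Finset.mem_univ _) (fun p _ => p.swap_swap)
  · have h := congrFun (congrFun hM.1 p.1) p.2
    simp only [transpose_apply, neg_apply] at h
    simp only [Prod.fst_swap, Prod.snd_swap, h]
    ring
  · have h' : p.2 = p.1 := congrArg Prod.fst h
    rw [h', hM.2, zero_mul, mul_zero]

theorem vecMul_eq (hM : M.IsAlternating) (x : Fin k → K) : x ᵥ* M = -(M *ᵥ x) := by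
  rw [← mulVec_transpose, hM.1, neg_mulVec]

theorem even_add_finrank_ker (hM : M.IsAlternating) :
    Even (k + finrank K (LinearMap.ker M.mulVecLin)) := by
  have hB : (Matrix.toLinearMap₂' K M : (Fin k → K) →ₗ[K] (Fin k → K) →ₗ[K] K).IsAlt :=
    fun x => by rw [toLinearMap₂'_apply', hM.dotProduct_mulVec_self]
  have hker : LinearMap.ker (Matrix.toLinearMap₂' K M : (Fin k → K) →ₗ[K] (Fin k → K) →ₗ[K] K) =
      LinearMap.ker M.mulVecLin := by
    ext x
    simp only [LinearMap.mem_ker, LinearMap.ext_iff, toLinearMap₂'_apply', dotProduct_mulVec,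
      hM.vecMul_eq, LinearMap.zero_apply, mulVecLin_apply, dotProduct_eq_zero_iff, neg_eq_zero]
  have h := hB.even_finrank_add_finrank_ker
  rwa [hker, finrank_fin_fun] at h

theorem range_le_of_ker_le (hM : M.IsAlternating) (hN : N.IsAlternating)
    (h : LinearMap.ker N.mulVecLin ≤ LinearMap.ker M.mulVecLin) :
    LinearMap.range M.mulVecLin ≤ LinearMap.range N.mulVecLin := by
  obtain ⟨g, hg⟩ := (LinearMap.exists_extend
    (((LinearMap.ker N.mulVecLin).liftQ M.mulVecLin h).comp
      N.mulVecLin.quotKerEquivRange.symm.toLinearMap))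
  have hS : M = LinearMap.toMatrix' g * N := by
    refine Matrix.mulVec_injective (funext fun x => ?_)
    have := LinearMap.congr_fun hg ⟨N.mulVecLin x, LinearMap.mem_range_self _ x⟩
    simp only [LinearMap.comp_apply, Submodule.subtype_apply, LinearEquiv.coe_coe,
      LinearMap.quotKerEquivRange_symm_apply_image N.mulVecLin x, Submodule.mkQ_apply,
      Submodule.liftQ_apply] at this
    rw [← mulVec_mulVec, LinearMap.toMatrix'_mulVec]
    exact this.symm
  have hT : M = N * (LinearMap.toMatrix' g)ᵀ := by
    have := congrArg transpose hS
    rw [transpose_mul, hM.1, hN.1, neg_mul, neg_inj] at this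
    exact this
  rintro _ ⟨x, rfl⟩
  exact ⟨(LinearMap.toMatrix' g)ᵀ *ᵥ x, by simp [mulVec_mulVec, ← hT]⟩

end Matrix.IsAlternating

/-- If `f ≠ 0` and the range of `g` lies in that of `f`, the pencil `g - c • f` has, for some `c`,
a kernel vector outside the kernel of `f`. -/
theorem LinearMap.exists_apply_eq_smul_apply {K F : Type*} [Field K] [IsAlgClosed K]
    [AddCommGroup F] [Module K F] [FiniteDimensional K F] {f g : F →ₗ[K] F} (hf : f ≠ 0)
    (hrange : LinearMap.range g ≤ LinearMap.range f) :
    ∃ c : K, ∃ x, g x = c • f x ∧ f x ≠ 0 := by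
  obtain ⟨s, hs⟩ := f.rangeRestrict.exists_rightInverse_of_surjective f.range_rangeRestrict
  have : Nontrivial (LinearMap.range f) :=
    Submodule.nontrivial_iff_ne_bot.2 (mt LinearMap.range_eq_bot.1 hf)
  let T : Module.End K (LinearMap.range f) :=
    (g.codRestrict (LinearMap.range f) fun x => hrange ⟨x, rfl⟩).comp s
  obtain ⟨c, hc⟩ := Module.End.exists_eigenvalue T
  obtain ⟨w, hw⟩ := hc.exists_hasEigenvector
  have hfw : f (s w) = w := congrArg Subtype.val (LinearMap.congr_fun hs w)
  refine ⟨c, s w, ?_, ?_⟩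
  · rw [hfw]
    exact congrArg Subtype.val hw.apply_eq_smul
  · rw [hfw]
    exact fun h => hw.2 (Subtype.ext h)

/-- Over an algebraically closed field `K`, let `B₁, B₂` be symplectic
forms on `E` and `V ⊆ E` a `k`-dimensional subspace isotropic for both.  If there are
alternating `k × k` matrices `A = (a i j)`, `M = (b i j)`, not both zero, and a basis
`v 1, ..., v k` of `V` with `B₁(Σ_j a i j • v j, e) + B₂(Σ_j b i j • v j, e) = 0` for all
`i` and all `e ∈ E`, then some nonzero combination `c₁ • B₁ + c₂ • B₂` vanishes on
`V' × E` for a nonzero even-dimensional subspace `V' ⊆ V`. -/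
theorem exists_even_dim_degenerate_subspace
    {K E : Type*} [Field K] [IsAlgClosed K] [AddCommGroup E] [Module K E]
    [FiniteDimensional K E]
    (k : ℕ) (B₁ B₂ : E →ₗ[K] E →ₗ[K] K)
    (h₁ : IsSymplectic B₁) (h₂ : IsSymplectic B₂)
    (V : Submodule K E) (hk : finrank K V = k)
    (hiso₁ : IsIsotropic B₁ V) (hiso₂ : IsIsotropic B₂ V)
    (A M : Matrix (Fin k) (Fin k) K)
    (hAalt : A.IsAlternating) (hMalt : M.IsAlternating)
    (hnz : ¬ (A = 0 ∧ M = 0))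
    (v : Basis (Fin k) K V)
    (hrel : ∀ i : Fin k, ∀ e : E,
      B₁ (∑ j : Fin k, A i j • (v j : E)) e + B₂ (∑ j : Fin k, M i j • (v j : E)) e = 0) :
    ∃ c₁ c₂ : K, ¬ (c₁ = 0 ∧ c₂ = 0) ∧
      ∃ V' : Submodule K E, V' ≤ V ∧ V' ≠ ⊥ ∧ Even (finrank K V') ∧
        ∀ v' ∈ V', ∀ e : E, c₁ * B₁ v' e + c₂ * B₂ v' e = 0 := by
  let ι : (Fin k → K) →ₗ[K] E := V.subtype.comp v.equivFun.symm.toLinearMap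
  have hι : Function.Injective ι := V.injective_subtype.comp v.equivFun.symm.injective
  have hι_apply : ∀ x, ι x = ∑ j, x j • (v j : E) := fun x => by
    simp [ι, Basis.equivFun_symm_apply]
  have hpencil : ∀ x, B₁ (ι (A *ᵥ x)) + B₂ (ι (M *ᵥ x)) = 0 := by
    intro x
    have hrow : ∀ i, B₁ (ι (A i)) + B₂ (ι (M i)) = 0 := fun i =>
      LinearMap.ext fun e => by
        simpa only [hι_apply, LinearMap.add_apply, LinearMap.zero_apply] using hrel i e
    have h : B₁ (ι (x ᵥ* A)) + B₂ (ι (x ᵥ* M)) = 0 := by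
      simp only [Matrix.vecMul_eq_sum, map_sum, map_smul, ← Finset.sum_add_distrib, ← smul_add]
      exact Finset.sum_eq_zero fun i _ => by
        rw [← smul_zero (x i), ← hrow i]
    rw [hAalt.vecMul_eq, hMalt.vecMul_eq, map_neg, map_neg, map_neg, map_neg, ← neg_add,
      neg_eq_zero] at h
    exact h
  have hker : LinearMap.ker A.mulVecLin ≤ LinearMap.ker M.mulVecLin := by
    intro x hx
    have h := hpencil x
    rw [LinearMap.mem_ker, Matrix.mulVecLin_apply] at hx
    rw [hx, map_zero, map_zero, zero_add] at h
    exact hι ((h₂.2 _ (LinearMap.congr_fun h)).trans (map_zero ι).symm)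
  have hA : A.mulVecLin ≠ 0 := by
    intro h
    rw [h, LinearMap.ker_zero, top_le_iff, LinearMap.ker_eq_top] at hker
    exact hnz ⟨Matrix.toLin'.map_eq_zero_iff.1 h, Matrix.toLin'.map_eq_zero_iff.1 hker⟩
  obtain ⟨c, x, hx, hx0⟩ := LinearMap.exists_apply_eq_smul_apply hA
    (hMalt.range_le_of_ker_le hAalt hker)
  let P := LinearMap.ker (M - c • A).mulVecLin
  have hP : ∀ y, y ∈ P ↔ M *ᵥ y = c • A *ᵥ y := fun y => by
    rw [LinearMap.mem_ker, Matrix.mulVecLin_apply, Matrix.sub_mulVec, Matrix.smul_mulVec,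
      sub_eq_zero]
  have hle : LinearMap.ker A.mulVecLin ≤ P := fun y hy => by
    have hy' := hker hy
    rw [LinearMap.mem_ker, Matrix.mulVecLin_apply] at hy hy'
    rw [hP, hy, hy', smul_zero]
  have hrank : finrank K (P.map A.mulVecLin) + finrank K (LinearMap.ker A.mulVecLin) =
      finrank K P := by
    have h := (A.mulVecLin.domRestrict P).finrank_range_add_finrank_ker
    rwa [LinearMap.range_domRestrict, LinearMap.ker_domRestrict,
      (Submodule.comapSubtypeEquivOfLe hle).finrank_eq] at h
  refine ⟨1, c, by simp, (P.map A.mulVecLin).map ι, ?_, ?_, ?_, ?_⟩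
  · rintro _ ⟨y, -, rfl⟩
    exact (v.equivFun.symm y).2
  · refine (Submodule.ne_bot_iff _).2 ⟨_, ⟨_, ⟨x, (hP x).2 hx, rfl⟩, rfl⟩, fun h => hx0 ?_⟩
    exact hι (h.trans (map_zero ι).symm)
  · rw [← (Submodule.equivMapOfInjective ι hι (P.map A.mulVecLin)).finrank_eq]
    have hA_even := hAalt.even_add_finrank_ker
    have hP_even := (hMalt.sub_smul hAalt c).even_add_finrank_ker
    change Even (k + finrank K P) at hP_even
    rw [← hrank] at hP_even
    grind
  · rintro _ ⟨_, ⟨y, hy, rfl⟩, rfl⟩ e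
    have h := LinearMap.congr_fun (hpencil y) e
    rw [(hP y).1 hy] at h
    simpa using h
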